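/- arXiv:2303.04041 — 2 statements merged into one kernel-verified Lean document; each statement's English description precedes it below -/
import Mathlib

section
/- For all integers q ≥ 2 and k with 1 ≤ k ≤ q(q−1)/2, and all reals d₁,…,d_k, there exist finitely many finite simple graphs H₁,…,H_m, each with exactly 3q² vertices, and real coefficients c₁,…,c_m, such that for every q-step kernel U: ∑_{t=1}^m c_t · t(H_t,U) = 0 if and only if the density between each pair of distinct parts of U is one of the reals d₁,…,d_k. -/
open MeasureTheory
open scoped BigOperators Classical

noncomputable section

abbrev I01 : Type := Set.Icc (0 : ℝ) 1

/-- A kernel: a bounded measurable symmetric function on `[0,1]²`. -/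
structure GKernel where
  toFun : I01 → I01 → ℝ
  measurable' : Measurable (Function.uncurry toFun)
  bounded' : ∃ C : ℝ, ∀ x y, |toFun x y| ≤ C
  symm' : ∀ x y, toFun x y = toFun y x

/-- A graphon is a kernel with values in `[0,1]`. -/
def GKernel.IsGraphon (U : GKernel) : Prop :=
  ∀ x y, U.toFun x y ∈ Set.Icc (0 : ℝ) 1

/-- Homomorphism density of a finite simple graph in a kernel. -/
def homDensity {n : ℕ} (H : SimpleGraph (Fin n)) (U : GKernel) : ℝ :=
  ∫ x : Fin n → I01,
    ∏ e ∈ (Set.toFinite H.edgeSet).toFinset,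
      Sym2.lift ⟨fun u v => U.toFun (x u) (x v), fun _ _ => U.symm' _ _⟩ e

/-- Two kernels are weakly isomorphic if all homomorphism densities coincide. -/
def WeaklyIsomorphic (U U' : GKernel) : Prop :=
  ∀ (n : ℕ) (H : SimpleGraph (Fin n)), homDensity H U = homDensity H U'

/-- `A` is a partition of `[0,1]` into `q` measurable parts of positive measure
on whose pairwise products `U` is constant. -/
def IsStepPartition (U : GKernel) {q : ℕ} (A : Fin q → Set I01) : Prop :=
  (∀ i, MeasurableSet (A i)) ∧
  (∀ i, 0 < volume (A i)) ∧
  Pairwise (fun i j => Disjoint (A i) (A j)) ∧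
  (⋃ i, A i) = Set.univ ∧
  (∀ i j, ∃ c : ℝ, ∀ x ∈ A i, ∀ y ∈ A j, U.toFun x y = c)

def HasStepPartition (U : GKernel) (q : ℕ) : Prop :=
  ∃ A : Fin q → Set I01, IsStepPartition U A

/-- A `q`-step kernel: a step partition into `q` parts exists but none into `q - 1` parts. -/
def IsStepKernel (U : GKernel) (q : ℕ) : Prop :=
  HasStepPartition U q ∧ ¬ HasStepPartition U (q - 1)

/-- The degree of a vertex `x` in a kernel. -/
def GKernel.degree (U : GKernel) (x : I01) : ℝ := ∫ y : I01, U.toFun x y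

/-- Density of a rooted graph (roots `R`, non-root vertices `Fin b`) in a kernel,
for a given choice `x` of the roots. -/
def rootedDensity {R : Type} [Fintype R] {b : ℕ}
    (H : SimpleGraph (R ⊕ Fin b)) (U : GKernel) (x : R → I01) : ℝ :=
  ∫ y : Fin b → I01,
    ∏ e ∈ (Set.toFinite H.edgeSet).toFinset,
      Sym2.lift ⟨fun u v => U.toFun (Sum.elim x y u) (Sum.elim x y v),
        fun _ _ => U.symm' _ _⟩ e

/-- `U` takes the constant value `v` on `A i × A j`. -/
def PartDensityIs (U : GKernel) {q : ℕ} (A : Fin q → Set I01) (i j : Fin q) (v : ℝ) : Prop :=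
  ∀ x ∈ A i, ∀ y ∈ A j, U.toFun x y = v

/-- A set of pairwise vertex-disjoint edges. -/
def IsMatchingSet {V : Type} (S : Set (Sym2 V)) : Prop :=
  (∀ e ∈ S, ¬ e.IsDiag) ∧
  ∀ e ∈ S, ∀ f ∈ S, e ≠ f → ∀ v : V, ¬ (v ∈ e ∧ v ∈ f)

/-- The edges of `S` with both endpoints in `V_i ∪ V_j`, where `V_l` is the set of
vertices with first coordinate `l`. -/
def EdgesIn {q : ℕ} {s : Fin q → ℕ} (S : Set (Sym2 ((l : Fin q) × Fin (s l))))
    (i j : Fin q) : Set (Sym2 ((l : Fin q) × Fin (s l))) :=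
  {e ∈ S | ∀ v ∈ e, v.1 = i ∨ v.1 = j}


/-- Edge values in a kernel given by a matrix and a colouring. -/
def edgeVal {W I : Type} (M : I → I → ℝ) (hM : ∀ i j, M i j = M j i) (φ : W → I) : Sym2 W → ℝ :=
  Sym2.lift ⟨fun u v => M (φ u) (φ v), fun _ _ => hM _ _⟩

lemma step_data {q : ℕ} (U : GKernel) (A : Fin q → Set I01) (h : IsStepPartition U A) :
    ∃ (cls : I01 → Fin q) (M : Fin q → Fin q → ℝ), Measurable cls ∧
      (∀ x i, cls x = i ↔ x ∈ A i) ∧ (∀ i j, M i j = M j i) ∧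
      (∀ x y, U.toFun x y = M (cls x) (cls y)) := by
  obtain ⟨hm, hp, hd, hu, hc⟩ := h
  have hx : ∀ x, ∃ i, x ∈ A i := by
    intro x
    have : x ∈ ⋃ i, A i := by rw [hu]; trivial
    simpa using this
  choose cls hcls using hx
  have hiff : ∀ x i, cls x = i ↔ x ∈ A i := by
    intro x i
    constructor
    · rintro rfl; exact hcls x
    · intro hxi
      by_contra hne
      exact Set.disjoint_left.mp (hd hne) (hcls x) hxi
  have hne : ∀ i, ∃ x, x ∈ A i := fun i => nonempty_of_measure_ne_zero (hp i).ne'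
  choose r hr using hne
  refine ⟨cls, fun i j => U.toFun (r i) (r j), ?_, hiff, fun i j => U.symm' _ _, ?_⟩
  · refine measurable_to_countable' fun i => ?_
    have : cls ⁻¹' {i} = A i := by ext x; simp [hiff]
    rw [this]; exact hm i
  · intro x y
    obtain ⟨c, hc⟩ := hc (cls x) (cls y)
    exact (hc x (hcls x) y (hcls y)).trans (hc _ (hr _) _ (hr _)).symm

lemma integral_cls {q n : ℕ} (A : Fin q → Set I01) (cls : I01 → Fin q) (hcm : Measurable cls)
    (hcls : ∀ x i, cls x = i ↔ x ∈ A i) (g : (Fin n → Fin q) → ℝ) :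
    ∫ x : Fin n → I01, g (fun v => cls (x v)) =
      ∑ φ : Fin n → Fin q, (∏ v, (volume (A (φ v))).toReal) * g φ := by
  have hmap : Measurable (fun (x : Fin n → I01) v => cls (x v)) :=
    measurable_pi_lambda _ fun v => hcm.comp (measurable_pi_apply v)
  have h1 : ∫ x : Fin n → I01, g (fun v => cls (x v)) =
      ∫ φ, g φ ∂((volume : Measure (Fin n → I01)).map (fun x v => cls (x v))) := by
    rw [integral_map hmap.aemeasurable]
    exact (measurable_of_finite g).aestronglyMeasurable
  have hfin : IsFiniteMeasure ((volume : Measure (Fin n → I01)).map (fun x v => cls (x v))) := by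
    infer_instance
  rw [h1, integral_fintype (Integrable.of_finite)]
  refine Finset.sum_congr rfl fun φ _ => ?_
  rw [smul_eq_mul, Measure.real, Measure.map_apply hmap (measurableSet_singleton _)]
  congr 1
  have : (fun (x : Fin n → I01) v => cls (x v)) ⁻¹' {φ} = Set.pi Set.univ (fun v => A (φ v)) := by
    ext x
    simp [funext_iff, hcls]
  rw [this, volume_pi_pi, ENNReal.toReal_prod]

lemma rows_distinct {q : ℕ} (U : GKernel) (A : Fin q → Set I01) (h : IsStepPartition U A)
    (hn : ¬ HasStepPartition U (q - 1)) (cls : I01 → Fin q) (M : Fin q → Fin q → ℝ)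
    (hcm : Measurable cls) (hcls : ∀ x i, cls x = i ↔ x ∈ A i) (hM : ∀ i j, M i j = M j i)
    (hU : ∀ x y, U.toFun x y = M (cls x) (cls y)) (i j : Fin q) (hij : i ≠ j) :
    ∃ l, M i l ≠ M j l := by
  by_contra! hall
  apply hn
  have hcard : Fintype.card {l : Fin q // l ≠ j} = q - 1 := by
    rw [Fintype.card_subtype_compl]; simp
  let g : {l : Fin q // l ≠ j} ≃ Fin (q - 1) := Fintype.equivFinOfCardEq hcard
  let r : Fin q → {l : Fin q // l ≠ j} := fun l => if hl : l = j then ⟨i, hij⟩ else ⟨l, hl⟩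
  have hr1 : ∀ l m, M (r l) m = M l m := by
    intro l m
    by_cases hl : l = j
    · subst hl; simp [r, hall]
    · simp [r, hl]
  have hr2 : ∀ l m, M (r l) (r m) = M l m := by
    intro l m
    rw [hr1, hM, hr1, hM]
  have hr3 : ∀ l : {l : Fin q // l ≠ j}, r l = l := by
    rintro ⟨l, hl⟩
    simp [r, hl]
  refine ⟨fun m => {x | g (r (cls x)) = m}, ?_, ?_, ?_, ?_, ?_⟩
  · intro m
    exact ((measurable_of_finite (fun l => g (r l))).comp hcm) (measurableSet_singleton m)
  · intro m
    refine lt_of_lt_of_le (h.2.1 (g.symm m)) (measure_mono ?_)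
    intro x hx
    have : cls x = g.symm m := (hcls _ _).2 hx
    simp [this, hr3]
  · intro m m' hmm
    rw [Set.disjoint_left]
    rintro x hx hx'
    exact hmm (hx.symm.trans hx')
  · ext x; simp
  · intro m m'
    refine ⟨M (g.symm m) (g.symm m'), ?_⟩
    rintro x hx y hy
    have hx' : g (r (cls x)) = m := hx
    have hy' : g (r (cls y)) = m' := hy
    rw [hU, ← hr2, ← hx', ← hy']
    simp

/-- Multilinear polynomials in edge variables from `E`. -/
def MLin {W : Type} (E : Finset (Sym2 W)) : Submodule ℝ ((Sym2 W → ℝ) → ℝ) :=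
  Submodule.span ℝ ((fun (S : Finset (Sym2 W)) (u : Sym2 W → ℝ) => ∏ e ∈ S, u e) '' {S | S ⊆ E})

lemma MLin.mono_mem {W : Type} {E S : Finset (Sym2 W)} (h : S ⊆ E) :
    (fun u : Sym2 W → ℝ => ∏ e ∈ S, u e) ∈ MLin E :=
  Submodule.subset_span ⟨S, h, rfl⟩

lemma MLin.mul_mem {W : Type} {E E' : Finset (Sym2 W)} (hd : Disjoint E E')
    {f g : (Sym2 W → ℝ) → ℝ} (hf : f ∈ MLin E) (hg : g ∈ MLin E') : f * g ∈ MLin (E ∪ E') := by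
  have := Submodule.mul_mem_mul hf hg
  rw [MLin, MLin, Submodule.span_mul_span] at this
  refine Submodule.span_mono ?_ this
  rintro _ ⟨_, ⟨S, hS, rfl⟩, _, ⟨S', hS', rfl⟩, rfl⟩
  refine ⟨S ∪ S', Finset.union_subset_union hS hS', ?_⟩
  funext u
  simp only [Pi.mul_apply]
  exact Finset.prod_union (Finset.disjoint_of_subset_left hS
    (Finset.disjoint_of_subset_right hS' hd))

lemma MLin.prod_mem {W T : Type} (E : T → Finset (Sym2 W)) (f : T → (Sym2 W → ℝ) → ℝ)
    (hd : ∀ t t', t ≠ t' → Disjoint (E t) (E t')) (hf : ∀ t, f t ∈ MLin (E t)) (s : Finset T) :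
    ∏ t ∈ s, f t ∈ MLin (s.biUnion E) := by
  induction s using Finset.induction_on with
  | empty =>
    have := MLin.mono_mem (W := W) (E := ∅) (S := ∅) (by simp)
    simp only [Finset.prod_empty] at this ⊢
    exact this
  | insert a s ha ih =>
    rw [Finset.prod_insert ha, Finset.biUnion_insert]
    refine MLin.mul_mem ?_ (hf a) ih
    rw [Finset.disjoint_biUnion_right]
    intro t ht
    exact hd _ _ (by rintro rfl; exact ha ht)

lemma MLin.graphs {n : ℕ} (E : Finset (Sym2 (Fin n))) (hE : ∀ e ∈ E, ¬ e.IsDiag)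
    (F : (Sym2 (Fin n) → ℝ) → ℝ) (hF : F ∈ MLin E) :
    ∃ (m : ℕ) (H : Fin m → SimpleGraph (Fin n)) (c : Fin m → ℝ),
      ∀ u, F u = ∑ t, c t * ∏ e ∈ (Set.toFinite (H t).edgeSet).toFinset, u e := by
  obtain ⟨m, ⟨eq⟩⟩ := Finite.exists_equiv_fin (SimpleGraph (Fin n))
  refine ⟨m, eq.symm, ?_⟩
  have : F ∈ Submodule.span ℝ (Set.range (fun (t : Fin m) (u : Sym2 (Fin n) → ℝ) =>
      ∏ e ∈ (Set.toFinite (eq.symm t).edgeSet).toFinset, u e)) := by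
    refine Submodule.span_mono ?_ hF
    rintro _ ⟨S, hS, rfl⟩
    refine ⟨eq (SimpleGraph.fromEdgeSet (S : Set (Sym2 (Fin n)))), ?_⟩
    funext u
    refine Finset.prod_congr ?_ fun _ _ => rfl
    ext e
    simp only [Equiv.symm_apply_apply, Set.Finite.mem_toFinset, SimpleGraph.edgeSet_fromEdgeSet]
    constructor
    · intro h; exact h.1
    · intro h; exact ⟨h, hE e (hS h)⟩
  rw [Submodule.mem_span_range_iff_exists_fun] at this
  obtain ⟨c, hc⟩ := this
  refine ⟨c, fun u => ?_⟩
  rw [← hc]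
  simp

lemma homDensity_eq {q n : ℕ} (U : GKernel) (A : Fin q → Set I01) (cls : I01 → Fin q)
    (M : Fin q → Fin q → ℝ)
    (hcm : Measurable cls) (hcls : ∀ x i, cls x = i ↔ x ∈ A i) (hM : ∀ i j, M i j = M j i)
    (hU : ∀ x y, U.toFun x y = M (cls x) (cls y)) (H : SimpleGraph (Fin n)) :
    homDensity H U = ∑ φ : Fin n → Fin q, (∏ v, (volume (A (φ v))).toReal) *
      ∏ e ∈ (Set.toFinite H.edgeSet).toFinset, edgeVal M hM φ e := by
  rw [← integral_cls A cls hcm hcls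
    (fun φ => ∏ e ∈ (Set.toFinite H.edgeSet).toFinset, edgeVal M hM φ e)]
  unfold homDensity
  congr 1
  funext x
  refine Finset.prod_congr rfl fun e _ => ?_
  induction e using Sym2.ind with
  | _ a b => simp [edgeVal, hU]

/-- Cyclic shift or identity. -/
def shf {s : ℕ} [NeZero s] (b : Bool) (a : Fin s) : Fin s := if b then a + 1 else a

lemma shf_inj {s : ℕ} [NeZero s] (b : Bool) (a a' : Fin s) (h : shf b a = shf b a') : a = a' := by
  cases b <;> simpa [shf] using h

abbrev OffP (q : ℕ) : Type := {p : Fin q × Fin q // p.1 ≠ p.2}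
abbrev VT (q s : ℕ) : Type := (Fin q × Fin s) ⊕ (OffP q × Bool)
abbrev TT (q s : ℕ) : Type := (OffP q × Bool) × Fin s

section gadget
variable {W : Type} {q s : ℕ} [NeZero s] (ι : VT q s ↪ W)

def ed1 (t : TT q s) : Sym2 W := s(ι (Sum.inl (t.1.1.1.1, shf t.1.2 t.2)), ι (Sum.inr t.1))
def ed2 (t : TT q s) : Sym2 W := s(ι (Sum.inl (t.1.1.1.2, t.2)), ι (Sum.inr t.1))

def gad (t : TT q s) (u : Sym2 W → ℝ) : ℝ := u (ed1 ι t) - u (ed2 ι t)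

def edT (t : TT q s) : Finset (Sym2 W) := {ed1 ι t, ed2 ι t}

lemma gad_mem (t : TT q s) : gad ι t ∈ MLin (edT ι t) := by
  have h1 := MLin.mono_mem (E := edT ι t) (S := {ed1 ι t}) (by simp [edT])
  have h2 := MLin.mono_mem (E := edT ι t) (S := {ed2 ι t}) (by simp [edT])
  have := Submodule.sub_mem _ h1 h2
  simp only [Finset.prod_singleton] at this
  exact this

lemma edT_disj (t t' : TT q s) (h : t ≠ t') : Disjoint (edT ι t) (edT ι t') := by
  rw [Finset.disjoint_left]
  obtain ⟨⟨⟨⟨i, j⟩, hij⟩, b⟩, a⟩ := t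
  obtain ⟨⟨⟨⟨i', j'⟩, hij'⟩, b'⟩, a'⟩ := t'
  intro e he he'
  apply h
  simp only [ne_eq] at hij hij'
  simp only [edT, Finset.mem_insert, Finset.mem_singleton, ed1, ed2] at he he'
  rcases he with rfl | rfl <;> rcases he' with he' | he' <;>
    simp at he' <;> obtain ⟨⟨h1, h2⟩, ⟨h3, h4⟩, h5⟩ := he' <;> subst h3 h4 h5
  · have := shf_inj _ _ _ h2
    subst this; rfl
  · exact absurd h1 hij
  · exact absurd h1.symm hij
  · subst h2; rfl

/-- Edges between two classes. -/
def edQ (i j : Fin q) : Finset (Sym2 W) :=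
  Finset.univ.image (fun a : Fin s × Fin s => s(ι (Sum.inl (i, a.1)), ι (Sum.inl (j, a.2))))

lemma edQ_card (i j : Fin q) (hij : i ≠ j) : (edQ ι i j).card = s * s := by
  rw [edQ, Finset.card_image_of_injective]
  · simp
  · rintro ⟨a, b⟩ ⟨a', b'⟩ h
    simp at h
    rcases h with ⟨rfl, rfl⟩ | ⟨⟨h, _⟩, _⟩
    · rfl
    · exact absurd h hij

lemma edQ_disj (i j : Fin q) (t : TT q s) : Disjoint (edT ι t) (edQ ι i j) := by
  rw [Finset.disjoint_left]
  intro e he he'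
  simp only [edQ, Finset.mem_image] at he'
  obtain ⟨a, _, rfl⟩ := he'
  simp [edT, ed1, ed2] at he

lemma good_edges (i j : Fin q) (hij : i ≠ j) :
    ∀ e ∈ Finset.univ.biUnion (edT ι) ∪ edQ ι i j, ¬ e.IsDiag := by
  intro e he
  rw [Finset.mem_union, Finset.mem_biUnion] at he
  rcases he with ⟨t, _, ht⟩ | he
  · simp only [edT, Finset.mem_insert, Finset.mem_singleton, ed1, ed2] at ht
    rcases ht with rfl | rfl <;> simp
  · simp only [edQ, Finset.mem_image] at he
    obtain ⟨a, _, rfl⟩ := he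
    simp [hij]

lemma full_mem (i j : Fin q) (Q : (Sym2 W → ℝ) → ℝ) (hQ : Q ∈ MLin (edQ ι i j)) :
    (∏ t, gad ι t) * Q ∈ MLin (Finset.univ.biUnion (edT ι) ∪ edQ ι i j) := by
  refine MLin.mul_mem ?_
    (MLin.prod_mem (edT ι) (gad ι) (edT_disj ι) (gad_mem ι) Finset.univ) hQ
  rw [Finset.disjoint_biUnion_left]
  intro t _
  exact edQ_disj ι i j t

end gadget

/-- The polynomial part. -/
lemma Qpart {W : Type} (E : Finset (Sym2 W)) (p : Polynomial ℝ) (hp : p.natDegree ≤ E.card) :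
    ∃ Q : (Sym2 W → ℝ) → ℝ, Q ∈ MLin E ∧
      ∀ u x, (∀ e ∈ E, u e = x) → Q u = p.eval x := by
  have : ∀ r : ℕ, ∃ S, S ⊆ E ∧ (r ≤ E.card → S.card = r) := by
    intro r
    by_cases hr : r ≤ E.card
    · obtain ⟨S, hS, hc⟩ := Finset.exists_subset_card_eq hr
      exact ⟨S, hS, fun _ => hc⟩
    · exact ⟨∅, by simp, fun h => absurd h hr⟩
  choose S hS hc using this
  refine ⟨∑ r ∈ Finset.range (p.natDegree + 1), p.coeff r • (fun u => ∏ e ∈ S r, u e), ?_, ?_⟩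
  · exact Submodule.sum_mem _ fun r _ => Submodule.smul_mem _ _ (MLin.mono_mem (hS r))
  · intro u x hu
    rw [Polynomial.eval_eq_sum_range, Finset.sum_apply]
    refine Finset.sum_congr rfl fun r hr => ?_
    rw [Pi.smul_apply, smul_eq_mul]
    congr 1
    rw [Finset.prod_congr rfl (fun e he => hu e (hS r he)), Finset.prod_const, hc]
    have := Finset.mem_range.mp hr
    omega

lemma gad_val {W : Type} {q s : ℕ} [NeZero s] (ι : VT q s ↪ W) (M : Fin q → Fin q → ℝ)
    (hM : ∀ i j, M i j = M j i) (φ : W → Fin q) (t : TT q s) :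
    gad ι t (edgeVal M hM φ) =
      M (φ (ι (Sum.inl (t.1.1.1.1, shf t.1.2 t.2)))) (φ (ι (Sum.inr t.1))) -
      M (φ (ι (Sum.inl (t.1.1.1.2, t.2)))) (φ (ι (Sum.inr t.1))) := rfl

lemma coherent {W : Type} {q s : ℕ} [NeZero s] (ι : VT q s ↪ W) (φ : W → Fin q)
    (h : ∀ t : TT q s, φ (ι (Sum.inl (t.1.1.1.1, shf t.1.2 t.2))) ≠
      φ (ι (Sum.inl (t.1.1.1.2, t.2)))) :
    ∃ π : Fin q → Fin q, Function.Injective π ∧ ∀ i a, φ (ι (Sum.inl (i, a))) = π i := by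
  have h0 : ∀ a : Fin s, Function.Injective (fun i => φ (ι (Sum.inl (i, a)))) := by
    intro a i j hij
    by_contra hne
    exact h (((⟨(i, j), hne⟩, false), a)) (by simpa [shf] using hij)
  have h1 : ∀ (a : Fin s) i, φ (ι (Sum.inl (i, a + 1))) = φ (ι (Sum.inl (i, a))) := by
    intro a i
    obtain ⟨j, hj⟩ := Finite.surjective_of_injective (h0 a) (φ (ι (Sum.inl (i, a + 1))))
    simp only at hj
    by_cases hij : i = j
    · rw [← hj, hij]
    · exact absurd hj.symm (h (((⟨(i, j), hij⟩, true), a)))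
  refine ⟨fun i => φ (ι (Sum.inl (i, 0))), h0 0, fun i a => ?_⟩
  obtain ⟨s', rfl⟩ := Nat.exists_eq_succ_of_ne_zero (NeZero.ne s)
  induction a using Fin.induction with
  | zero => rfl
  | succ a ih => rw [← Fin.coeSucc_eq_succ, h1, ih]

theorem statement8 (q k : ℕ) (hq : 2 ≤ q) (hk1 : 1 ≤ k) (hkq : k ≤ q * (q - 1) / 2)
    (d : Fin k → ℝ) :
    ∃ (m : ℕ) (H : Fin m → SimpleGraph (Fin (3 * q ^ 2))) (c : Fin m → ℝ),
      ∀ (U : GKernel) (A : Fin q → Set I01),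
        IsStepPartition U A → ¬ HasStepPartition U (q - 1) →
        ((∑ t, c t * homDensity (H t) U) = 0 ↔
          ∀ i j : Fin q, i ≠ j → ∃ l : Fin k, PartDensityIs U A i j (d l)) := by
  have hex : ∃ s : ℕ, Even s ∧ q ≤ s ∧ s ≤ q + 1 := by
    rcases Nat.even_or_odd q with h | h
    · exact ⟨q, h, le_rfl, by omega⟩
    · exact ⟨q + 1, h.add_one, by omega, le_rfl⟩
  obtain ⟨s, hse, hqs, hsq⟩ := hex
  have : NeZero s := ⟨by omega⟩
  have hcardO : Fintype.card (OffP q) = q * q - q := by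
    rw [Fintype.card_subtype]
    have h1 : (Finset.univ.filter (fun p : Fin q × Fin q => p.1 ≠ p.2)) =
      (Finset.univ : Finset (Fin q)).offDiag := by
        ext p; simp
    rw [h1, Finset.offDiag_card]; simp
  have hcard : Fintype.card (VT q s) ≤ Fintype.card (Fin (3 * q ^ 2)) := by
    simp only [Fintype.card_sum, Fintype.card_prod, hcardO, Fintype.card_fin, Fintype.card_bool]
    have h1 : q * s ≤ q * (q + 1) := Nat.mul_le_mul_left _ hsq
    have h2 : q ≤ q * q := Nat.le_mul_self q
    have h3 : q ^ 2 = q * q := by ring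
    have h4 : q * (q + 1) = q * q + q := by ring
    omega
  obtain ⟨ι⟩ := Function.Embedding.nonempty_of_card_le hcard
  let i0 : Fin q := ⟨0, by omega⟩
  let i1 : Fin q := ⟨1, by omega⟩
  have h01 : i0 ≠ i1 := by simp [i0, i1]
  let p : Polynomial ℝ := ∏ l, (Polynomial.X - Polynomial.C (d l))
  have hpdeg : p.natDegree = k := by
    simp [p, Polynomial.natDegree_prod_of_monic _ _ (fun l _ => Polynomial.monic_X_sub_C (d l))]
  have hroot : ∀ x, p.eval x = 0 ↔ ∃ l, x = d l := by
    intro x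
    simp [p, Polynomial.eval_prod, Finset.prod_eq_zero_iff, sub_eq_zero]
  obtain ⟨Q, hQ, hQv⟩ := Qpart (edQ ι i0 i1) (p ^ 2) (by
    rw [edQ_card ι i0 i1 h01]
    refine Polynomial.natDegree_pow_le.trans ?_
    rw [hpdeg]
    have h1 : 2 * k ≤ q * (q - 1) := by omega
    exact h1.trans (Nat.mul_le_mul hqs (by omega)))
  have hF := full_mem ι i0 i1 Q hQ
  obtain ⟨m, H, c, hH⟩ := MLin.graphs _ (good_edges ι i0 i1 h01) _ hF
  refine ⟨m, H, c, fun U A hA hn => ?_⟩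
  obtain ⟨cls, M, hcm, hcls, hM, hU⟩ := step_data U A hA
  have hrows := rows_distinct U A hA hn cls M hcm hcls hM hU
  set F : (Sym2 (Fin (3 * q ^ 2)) → ℝ) → ℝ := (∏ t, gad ι t) * Q with hFdef
  have hFv : ∀ u, F u = (∏ t, gad ι t u) * Q u := by
    intro u; simp [hFdef]
  have hsum : (∑ t, c t * homDensity (H t) U) =
      ∑ φ : Fin (3 * q ^ 2) → Fin q, (∏ v, (volume (A (φ v))).toReal) * F (edgeVal M hM φ) := by
    simp_rw [homDensity_eq U A cls M hcm hcls hM hU, hH, Finset.mul_sum]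
    rw [Finset.sum_comm]
    refine Finset.sum_congr rfl fun φ _ => Finset.sum_congr rfl fun t _ => ?_
    ring
  have hdens : ∀ i j v, PartDensityIs U A i j v ↔ M i j = v := by
    intro i j v
    constructor
    · intro h
      obtain ⟨x, hx⟩ := nonempty_of_measure_ne_zero (hA.2.1 i).ne'
      obtain ⟨y, hy⟩ := nonempty_of_measure_ne_zero (hA.2.1 j).ne'
      have := h x hx y hy
      rwa [hU, (hcls x i).2 hx, (hcls y j).2 hy] at this
    · intro h x hx y hy
      rw [hU, (hcls x i).2 hx, (hcls y j).2 hy, h]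
  have hQe : ∀ (φ : Fin (3 * q ^ 2) → Fin q) (π : Fin q → Fin q),
      (∀ i a, φ (ι (Sum.inl (i, a))) = π i) →
      Q (edgeVal M hM φ) = (p.eval (M (π i0) (π i1))) ^ 2 := by
    intro φ π hπ
    rw [hQv _ (M (π i0) (π i1)), Polynomial.eval_pow]
    intro e he
    simp only [edQ, Finset.mem_image] at he
    obtain ⟨a, _, rfl⟩ := he
    simp [edgeVal, hπ]
  have hcoh : ∀ φ : Fin (3 * q ^ 2) → Fin q, F (edgeVal M hM φ) = 0 ∨
      ∃ π : Fin q → Fin q, Function.Injective π ∧ ∀ i a, φ (ι (Sum.inl (i, a))) = π i := by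
    intro φ
    by_cases h : ∀ t : TT q s, φ (ι (Sum.inl (t.1.1.1.1, shf t.1.2 t.2))) ≠
      φ (ι (Sum.inl (t.1.1.1.2, t.2)))
    · exact Or.inr (coherent ι φ h)
    · left
      push Not at h
      obtain ⟨t, ht⟩ := h
      rw [hFv, Finset.prod_eq_zero (Finset.mem_univ t), zero_mul]
      rw [gad_val, ht, sub_self]
  have hgad : ∀ (φ : Fin (3 * q ^ 2) → Fin q) (π : Fin q → Fin q),
      (∀ i a, φ (ι (Sum.inl (i, a))) = π i) →
      (∏ t, gad ι t (edgeVal M hM φ)) = ∏ t : OffP q × Bool,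
        (M (π t.1.1.1) (φ (ι (Sum.inr t))) - M (π t.1.1.2) (φ (ι (Sum.inr t)))) ^ s := by
    intro φ π hπ
    rw [Fintype.prod_prod_type]
    refine Finset.prod_congr rfl fun t _ => ?_
    simp [gad_val, hπ]
  have hnn : ∀ φ, 0 ≤ F (edgeVal M hM φ) := by
    intro φ
    rcases hcoh φ with h | ⟨π, _, hπ⟩
    · exact h.ge
    · rw [hFv, hQe φ π hπ, hgad φ π hπ]
      exact mul_nonneg (Finset.prod_nonneg fun t _ => hse.pow_nonneg _) (sq_nonneg _)
  have hw : ∀ φ : Fin (3 * q ^ 2) → Fin q, 0 < ∏ v, (volume (A (φ v))).toReal := by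
    intro φ
    refine Finset.prod_pos fun v _ => ENNReal.toReal_pos (hA.2.1 _).ne' (measure_ne_top _ _)
  rw [hsum, Finset.sum_eq_zero_iff_of_nonneg (fun φ _ => mul_nonneg (hw φ).le (hnn φ))]
  constructor
  · intro h i j hij
    simp_rw [hdens]
    rw [← hroot]
    -- a permutation moving `i0, i1` to `i, j`
    obtain ⟨π, hπ, hπ0, hπ1⟩ : ∃ π : Fin q → Fin q, Function.Injective π ∧ π i0 = i ∧ π i1 = j := by
      let σ := Equiv.swap i0 i
      refine ⟨fun x => Equiv.swap (σ i1) j (σ x),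
        (Equiv.injective _).comp (Equiv.injective _), ?_, ?_⟩
      · have h1 : σ i0 = i := by simp [σ]
        have h2 : i ≠ σ i1 := by
          rw [← h1]; exact fun h => h01 (σ.injective h)
        simp only [h1]
        exact Equiv.swap_apply_of_ne_of_ne h2 hij
      · simp
    choose! y hy using hrows
    let ψ : VT q s → Fin q :=
      Sum.elim (fun z => π z.1) (fun t => y (π t.1.1.1) (π t.1.1.2))
    let φ : Fin (3 * q ^ 2) → Fin q := Function.extend ι ψ (fun _ => i0)
    have hφ : ∀ v, φ (ι v) = ψ v := fun v => ι.injective.extend_apply _ _ _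
    have hπφ : ∀ i a, φ (ι (Sum.inl (i, a))) = π i := fun i a => by rw [hφ]; rfl
    have h0 := h φ (Finset.mem_univ _)
    rw [hFv, hQe φ π hπφ, hgad φ π hπφ, hπ0, hπ1] at h0
    rcases mul_eq_zero.mp h0 with h0 | h0
    · exact absurd h0 (hw φ).ne'
    rcases mul_eq_zero.mp h0 with h0 | h0
    · rw [Finset.prod_eq_zero_iff] at h0
      obtain ⟨t, _, ht⟩ := h0
      have := eq_zero_of_pow_eq_zero ht
      rw [hφ] at this
      exact absurd (sub_eq_zero.mp this) (hy _ _ (fun h => t.1.2 (hπ h)))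
    · exact eq_zero_of_pow_eq_zero h0
  · intro h φ _
    rcases hcoh φ with h' | ⟨π, hinj, hπ⟩
    · rw [h', mul_zero]
    · obtain ⟨l, hl⟩ := h (π i0) (π i1) (fun h => h01 (hinj h))
      rw [hdens] at hl
      rw [hFv, hQe φ π hπ, (hroot _).2 ⟨l, hl⟩]
      simp

end
end

section
/- For every integer q ≥ 2 there exist two graphons W and W', each of which is a (q+1)-step graphon, such that t(H,W) = t(H,W') for every finite simple graph H with at most q vertices, yet W and W' are not weakly isomorphic, i.e., there exists a finite simple graph H₀ with t(H₀,W) ≠ t(H₀,W'). -/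
open MeasureTheory
open scoped BigOperators Classical

noncomputable section

namespace S11

/-- alternating trigonometric power sums -/
def E (n m : ℕ) (j : ℤ) : ℝ :=
  ∑ l ∈ Finset.range (2 * n), (-1 : ℝ) ^ l * (2 + Real.cos (Real.pi * l / n)) ^ m *
    Real.cos (j * (Real.pi * l / n))

theorem E_succ (n m : ℕ) (j : ℤ) :
    E n (m + 1) j = 2 * E n m j + (E n m (j + 1) + E n m (j - 1)) / 2 := by
  unfold E
  rw [← Finset.sum_add_distrib, Finset.sum_div, Finset.mul_sum, ← Finset.sum_add_distrib]
  refine Finset.sum_congr rfl fun l _ => ?_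
  push_cast
  rw [add_mul, sub_mul, one_mul, Real.cos_add, Real.cos_sub]
  ring

theorem E_zero_lt (n : ℕ) (hn : 0 < n) (j : ℤ) (hj : |j| < n) : E n 0 j = 0 := by
  have hn0 : (n : ℂ) ≠ 0 := by exact_mod_cast hn.ne'
  set w : ℂ := Complex.exp (((j + n : ℤ) : ℂ) * (Real.pi * Complex.I / n)) with hw
  have hw1 : w ≠ 1 := by
    rw [hw, Ne, Complex.exp_eq_one_iff]
    rintro ⟨k, hk⟩
    have hpi : (Real.pi : ℂ) * Complex.I ≠ 0 := by simp [Real.pi_ne_zero]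
    have h2 : ((j + n : ℤ) : ℂ) = k * 2 * n := by
      field_simp at hk
      have : (Real.pi * Complex.I : ℂ) * ((j + n : ℤ) : ℂ) = (Real.pi * Complex.I) * (k * 2 * n) := by
        linear_combination (Real.pi * Complex.I : ℂ) * hk
      exact mul_left_cancel₀ hpi this
    have h3 : j + n = k * 2 * n := by exact_mod_cast h2
    rw [abs_lt] at hj
    have h4 : 0 < k * 2 * n := by omega
    have h5 : k * 2 * (n:ℤ) < 2 * n := by omega
    have hnz : (0 : ℤ) < n := by exact_mod_cast hn
    have : 0 < k := by
      by_contra h; push Not at h; nlinarith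
    nlinarith
  have hwn : w ^ (2 * n) = 1 := by
    rw [hw, ← Complex.exp_nat_mul, Complex.exp_eq_one_iff]
    refine ⟨j + n, ?_⟩
    push_cast
    field_simp
  have hs : ∑ l ∈ Finset.range (2 * n), w ^ l = 0 := by
    have := geom_sum_mul w (2 * n)
    rw [hwn, sub_self] at this
    exact (mul_eq_zero.1 this).resolve_right (sub_ne_zero.2 hw1)
  have := congrArg Complex.re hs
  rw [Complex.re_sum, Complex.zero_re] at this
  rw [← this, E]
  refine Finset.sum_congr rfl fun l _ => ?_
  have hn0' : (n : ℝ) ≠ 0 := by exact_mod_cast hn.ne'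
  have : (l : ℂ) * (((j + n : ℤ) : ℂ) * (Real.pi * Complex.I / n)) =
      ((j * (Real.pi * l / n) + l * Real.pi : ℝ) : ℂ) * Complex.I := by
    push_cast
    field_simp
  rw [hw, ← Complex.exp_nat_mul, this, Complex.exp_ofReal_mul_I_re, Real.cos_add_nat_mul_pi]
  ring

theorem E_zero_eq (n : ℕ) (hn : 0 < n) (j : ℤ) (hj : |j| = n) : 0 < E n 0 j := by
  have hn0' : (n : ℝ) ≠ 0 := by exact_mod_cast hn.ne'
  have key : ∀ l : ℕ, Real.cos (j * (Real.pi * l / n)) = (-1) ^ l := by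
    intro l
    have h0 : Real.cos (n * (Real.pi * l / n)) = (-1) ^ l := by
      rw [mul_div_cancel₀ _ hn0', mul_comm, Real.cos_nat_mul_pi]
    rcases (abs_eq (by positivity)).1 hj with h | h
    · rw [h]; exact_mod_cast h0
    · rw [h]; push_cast; rw [neg_mul, Real.cos_neg]; exact_mod_cast h0
  unfold E
  refine Finset.sum_pos (fun l _ => ?_) ⟨0, by simp [hn]⟩
  rw [key, pow_zero, mul_one, ← mul_pow]; simp

theorem E_lt (n : ℕ) (hn : 0 < n) (m : ℕ) : ∀ j : ℤ, |j| + m < n → E n m j = 0 := by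
  induction m with
  | zero => intro j hj; exact E_zero_lt n hn j (by simpa using hj)
  | succ m ih =>
    intro j hj
    rw [E_succ, ih j (by push_cast at hj; omega),
      ih (j + 1) (by push_cast at hj; grind), ih (j - 1) (by push_cast at hj; grind)]
    simp

theorem E_eq (n : ℕ) (hn : 0 < n) (m : ℕ) : ∀ j : ℤ, |j| + m = n → 0 < E n m j := by
  induction m with
  | zero => intro j hj; exact E_zero_eq n hn j (by simpa using hj)
  | succ m ih =>
    intro j hj
    push_cast at hj
    rw [E_succ, E_lt n hn m j (by omega)]
    rcases le_total 0 j with h | h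
    · have h1 := ih (j + 1) (by grind)
      have h2 : 0 ≤ E n m (j - 1) := by
        rcases eq_or_ne j 0 with h0 | h0
        · exact (ih (j - 1) (by grind)).le
        · exact (E_lt n hn m _ (by grind)).ge
      linarith
    · have h1 := ih (j - 1) (by grind)
      have h2 : 0 ≤ E n m (j + 1) := by
        rcases eq_or_ne j 0 with h0 | h0
        · exact (ih (j + 1) (by grind)).le
        · exact (E_lt n hn m _ (by grind)).ge
      linarith

theorem sum_even_odd (f : ℕ → ℝ) (n : ℕ) :
    ∑ l ∈ Finset.range (2 * n), (-1 : ℝ) ^ l * f l =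
      ∑ k : Fin n, f (2 * k) - ∑ k : Fin n, f (2 * k + 1) := by
  rw [Fin.sum_univ_eq_sum_range (fun k => f (2 * k)),
    Fin.sum_univ_eq_sum_range (fun k => f (2 * k + 1))]
  induction n with
  | zero => simp
  | succ n ih =>
    rw [show 2 * (n + 1) = 2 * n + 1 + 1 by ring, Finset.sum_range_succ, Finset.sum_range_succ, ih,
      Finset.sum_range_succ, Finset.sum_range_succ]
    simp [pow_succ, pow_mul]
    ring

theorem exists_weights (q : ℕ) (hq : 2 ≤ q) :
    ∃ a b : Fin (q + 1) → ℝ, (∀ i, 0 < a i) ∧ (∀ i, 0 < b i) ∧ ∑ i, a i = 1 ∧ ∑ i, b i = 1 ∧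
      (∀ m ≤ q, ∑ i, a i ^ m = ∑ i, b i ^ m) ∧
      ∑ i, a i ^ (q + 1) ≠ ∑ i, b i ^ (q + 1) := by
  set n := q + 1 with hn
  let β : ℕ → ℝ := fun l => 2 + Real.cos (Real.pi * l / n)
  have hβ : ∀ l, 0 < β l := fun l => by
    have := Real.neg_one_le_cos (Real.pi * l / n)
    simp only [β]; linarith
  have hE : ∀ m, E n m 0 = ∑ k : Fin n, β (2 * k) ^ m - ∑ k : Fin n, β (2 * k + 1) ^ m := by
    intro m
    rw [← sum_even_odd (fun l => β l ^ m), E]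
    simp [β]
  have hlt : ∀ m ≤ q, ∑ k : Fin n, β (2 * k) ^ m = ∑ k : Fin n, β (2 * k + 1) ^ m := by
    intro m hm
    have := E_lt n (by omega) m 0 (by simp; omega)
    rw [hE] at this; linarith
  have heq := E_eq n (by omega) n 0 (by simp)
  rw [hE] at heq
  set S := ∑ k : Fin n, β (2 * k) with hS
  have h1 := hlt 1 (by omega)
  simp only [pow_one] at h1
  have hSpos : 0 < S := Finset.sum_pos (fun _ _ => hβ _) ⟨0, by simp⟩
  refine ⟨fun k => β (2 * k) / S, fun k => β (2 * k + 1) / S, fun _ => div_pos (hβ _) hSpos,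
    fun _ => div_pos (hβ _) hSpos, ?_, ?_, ?_, ?_⟩
  · rw [← Finset.sum_div, div_self hSpos.ne']
  · rw [← Finset.sum_div, ← h1, div_self hSpos.ne']
  · intro m hm
    simp only [div_pow, ← Finset.sum_div, hlt m hm]
  · simp only [div_pow, ← Finset.sum_div]
    intro h
    rw [div_left_inj' (pow_pos hSpos _).ne'] at h
    linarith

theorem exists_color {N : ℕ} (hN : 0 < N) (a : Fin N → ℝ) (ha : ∀ i, 0 < a i) (hs : ∑ i, a i = 1) :
    ∃ c : I01 → Fin N, Measurable c ∧ ∀ i, volume (c ⁻¹' {i}) = ENNReal.ofReal (a i) := by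
  have : Nonempty (Fin N) := ⟨⟨0, hN⟩⟩
  have hs' : ∑ i, ENNReal.ofReal (a i) = 1 := by
    rw [← ENNReal.ofReal_sum_of_nonneg (fun i _ => (ha i).le), hs, ENNReal.ofReal_one]
  let p : PMF (Fin N) := PMF.ofFintype (fun i => ENNReal.ofReal (a i)) hs'
  obtain ⟨c, hc, hm⟩ := p.toMeasure.exists_measurable_map_eq
  refine ⟨c, hc, fun i => ?_⟩
  have := congrArg (fun μ => μ {i}) hm
  rw [Measure.map_apply hc (measurableSet_singleton i),
    PMF.toMeasure_apply_singleton _ _ (measurableSet_singleton i)] at this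
  exact this

/-- disjoint union of cliques -/
def cliqueKernel {N : ℕ} (c : I01 → Fin N) (hc : Measurable c) : GKernel where
  toFun x y := if c x = c y then 1 else 0
  measurable' := by
    have h : Measurable (fun p : Fin N × Fin N => if p.1 = p.2 then (1 : ℝ) else 0) :=
      measurable_of_finite _
    exact h.comp ((hc.comp measurable_fst).prodMk (hc.comp measurable_snd))
  bounded' := ⟨1, fun x y => by split_ifs <;> simp⟩
  symm' x y := by simp only [eq_comm]

theorem clique_graphon {N : ℕ} (c : I01 → Fin N) (hc : Measurable c) :
    (cliqueKernel c hc).IsGraphon := by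
  intro x y
  simp only [cliqueKernel]
  split_ifs <;> simp

theorem clique_step {q : ℕ} (c : I01 → Fin (q + 1)) (hc : Measurable c)
    (hpos : ∀ i, 0 < volume (c ⁻¹' {i})) : IsStepKernel (cliqueKernel c hc) (q + 1) := by
  constructor
  · refine ⟨fun i => c ⁻¹' {i}, fun i => hc (measurableSet_singleton i), hpos, ?_, ?_, ?_⟩
    · intro i j hij
      exact Disjoint.preimage _ (by simpa using hij)
    · ext x; simp
    · intro i j
      refine ⟨if i = j then 1 else 0, fun x hx y hy => ?_⟩
      simp only [Set.mem_preimage, Set.mem_singleton_iff] at hx hy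
      simp only [cliqueKernel, hx, hy]
  · rintro ⟨B, -, -, -, hU, hB⟩
    have hne : ∀ i, ∃ x, c x = i := fun i => by
      obtain ⟨x, hx⟩ := nonempty_of_measure_ne_zero (hpos i).ne'
      exact ⟨x, hx⟩
    choose x hx using hne
    have hmem : ∀ i, ∃ k, x i ∈ B k := fun i => by
      have : x i ∈ ⋃ k, B k := by rw [hU]; trivial
      simpa using this
    choose k hk using hmem
    obtain ⟨i, j, hij, hkij⟩ := Fintype.exists_ne_map_eq_of_card_lt k (by simp)
    obtain ⟨d, hd⟩ := hB (k i) (k i)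
    have h1 := hd (x i) (hk i) (x i) (hk i)
    have h2 := hd (x i) (hk i) (x j) (hkij ▸ hk j)
    simp [cliqueKernel, hx, hij] at h1 h2
    rw [← h1] at h2
    simp at h2

theorem clique_density {N n : ℕ} (a : Fin N → ℝ) (ha : ∀ i, 0 < a i)
    (c : I01 → Fin N) (hc : Measurable c)
    (hv : ∀ i, volume (c ⁻¹' {i}) = ENNReal.ofReal (a i)) (H : SimpleGraph (Fin n)) :
    homDensity H (cliqueKernel c hc) =
      ∏ C : H.ConnectedComponent, ∑ i, a i ^ (Finset.univ.filter
        (fun v => H.connectedComponentMk v = C)).card := by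
  let g : (Fin n → Fin N) → ℝ := fun f => if ∀ u v, H.Adj u v → f u = f v then 1 else 0
  let μ : Measure (Fin N) := volume.map c
  have : IsProbabilityMeasure μ := Measure.isProbabilityMeasure_map hc.aemeasurable
  have hμ : ∀ i, μ.real {i} = a i := fun i => by
    rw [Measure.real, Measure.map_apply hc (measurableSet_singleton i), hv,
      ENNReal.toReal_ofReal (ha i).le]
  have h1 : homDensity H (cliqueKernel c hc) = ∫ x : Fin n → I01, g (fun v => c (x v)) := by
    unfold homDensity
    congr 1
    funext x
    simp only [g]
    split_ifs with h
    · refine Finset.prod_eq_one fun e he => ?_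
      induction e with | _ u v => ?_
      simp at he
      simp [cliqueKernel, h u v he]
    · push Not at h
      obtain ⟨u, v, huv, hne⟩ := h
      refine Finset.prod_eq_zero (i := s(u, v)) (by simpa using huv) ?_
      simp [cliqueKernel, hne]
  have hmp : MeasurePreserving (fun x : Fin n → I01 => fun v => c (x v)) volume
      (Measure.pi fun _ => μ) :=
    measurePreserving_pi (fun _ => volume) (fun _ => μ) (fun _ => ⟨hc, rfl⟩)
  have h2 : ∫ x : Fin n → I01, g (fun v => c (x v)) = ∫ f, g f ∂(Measure.pi fun _ => μ) := by
    rw [← hmp.map_eq, integral_map hmp.aemeasurable (measurable_of_finite g).aestronglyMeasurable]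
  have h3 : ∫ f, g f ∂(Measure.pi fun _ => μ) = ∑ f : Fin n → Fin N, (∏ v, a (f v)) * g f := by
    rw [integral_fintype (Integrable.of_finite)]
    refine Finset.sum_congr rfl fun f _ => ?_
    rw [smul_eq_mul, Measure.real, Measure.pi_singleton, ENNReal.toReal_prod]
    simp only [← hμ, Measure.real]
  rw [h1, h2, h3, Finset.prod_univ_sum, Fintype.piFinset_univ]
  have h4 : ∑ f : Fin n → Fin N, (∏ v, a (f v)) * g f =
      ∑ f ∈ Finset.univ.filter (fun f : Fin n → Fin N => ∀ u v, H.Adj u v → f u = f v),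
        ∏ v, a (f v) := by
    rw [Finset.sum_filter]
    refine Finset.sum_congr rfl fun f _ => ?_
    simp only [g, mul_ite, mul_one, mul_zero]
  rw [h4]
  symm
  refine Finset.sum_bij (fun φ _ => fun v => φ (H.connectedComponentMk v)) ?_ ?_ ?_ ?_
  · intro φ _
    simp only [Finset.mem_filter, Finset.mem_univ, true_and]
    intro u v huv
    rw [SimpleGraph.ConnectedComponent.sound huv.reachable]
  · intro φ _ ψ _ h
    funext C
    induction C using SimpleGraph.ConnectedComponent.ind with | _ v => ?_
    exact congrFun h v
  · intro f hf
    simp only [Finset.mem_filter, Finset.mem_univ, true_and] at hf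
    have hw : ∀ u v, H.Walk u v → f u = f v := by
      intro u v p
      induction p with
      | nil => rfl
      | cons h _ ih => exact (hf _ _ h).trans ih
    refine ⟨SimpleGraph.ConnectedComponent.lift f (fun u v p _ => hw u v p), by simp, ?_⟩
    funext v
    rfl
  · intro φ _
    rw [← Finset.prod_fiberwise Finset.univ (fun v => H.connectedComponentMk v)]
    refine Finset.prod_congr rfl fun C _ => ?_
    rw [← Finset.prod_const]
    refine Finset.prod_congr rfl fun v hv => ?_
    change a (φ C) = a (φ (H.connectedComponentMk v))
    rw [(Finset.mem_filter.1 hv).2]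

end S11

theorem statement11 (q : ℕ) (hq : 2 ≤ q) :
    ∃ W W' : GKernel, W.IsGraphon ∧ W'.IsGraphon ∧
      IsStepKernel W (q + 1) ∧ IsStepKernel W' (q + 1) ∧
      (∀ n : ℕ, n ≤ q → ∀ H : SimpleGraph (Fin n),
        homDensity H W = homDensity H W') ∧
      ∃ (n₀ : ℕ) (H₀ : SimpleGraph (Fin n₀)),
        homDensity H₀ W ≠ homDensity H₀ W' := by
  obtain ⟨a, b, ha, hb, hsa, hsb, hlt, hne⟩ := S11.exists_weights q hq
  obtain ⟨c, hc, hcv⟩ := S11.exists_color (Nat.succ_pos q) a ha hsa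
  obtain ⟨d, hd, hdv⟩ := S11.exists_color (Nat.succ_pos q) b hb hsb
  refine ⟨S11.cliqueKernel c hc, S11.cliqueKernel d hd, S11.clique_graphon c hc,
    S11.clique_graphon d hd, S11.clique_step c hc fun i => ?_, S11.clique_step d hd fun i => ?_,
    ?_, q + 1, ⊤, ?_⟩
  · rw [hcv]; exact ENNReal.ofReal_pos.2 (ha i)
  · rw [hdv]; exact ENNReal.ofReal_pos.2 (hb i)
  · intro n hn H
    rw [S11.clique_density a ha c hc hcv, S11.clique_density b hb d hd hdv]
    refine Finset.prod_congr rfl fun C _ => hlt _ ?_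
    exact (Finset.card_le_univ _).trans (by simpa using hn)
  · rw [S11.clique_density a ha c hc hcv, S11.clique_density b hb d hd hdv]
    have : Subsingleton (⊤ : SimpleGraph (Fin (q + 1))).ConnectedComponent :=
      SimpleGraph.preconnected_top.subsingleton_connectedComponent
    have hcard : ∀ C : (⊤ : SimpleGraph (Fin (q + 1))).ConnectedComponent,
        (Finset.univ.filter (fun v => (⊤ : SimpleGraph (Fin (q + 1))).connectedComponentMk v = C)).card
          = q + 1 := by
      intro C
      rw [Finset.filter_true_of_mem (fun v _ => Subsingleton.elim _ _)]
      simp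
    simp only [hcard]
    have hone : ∀ inst : Fintype (⊤ : SimpleGraph (Fin (q + 1))).ConnectedComponent,
        (@Finset.univ _ inst).card = 1 := fun inst =>
      le_antisymm (Fintype.card_le_one_iff_subsingleton.2 this)
        (Fintype.card_pos_iff.2 ⟨(⊤ : SimpleGraph (Fin (q + 1))).connectedComponentMk 0⟩)
    rw [Finset.prod_const, Finset.prod_const, hone, pow_one, pow_one]
    exact hne


end
end
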